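/- Let n, d be positive integers, G a connected subgraph of K_{n,d}, and M a G-tropical oriented matroid. Let S be the smallest subset of M containing every total refinement of G and closed under elimination results, i.e. whenever A, B ∈ S, i ∈ Fin n, and C ∈ M satisfies C_i = A_i ∪ B_i and C_{i'} ∈ {A_{i'}, B_{i'}, A_{i'} ∪ B_{i'}} for all i' ∈ Fin n, then C ∈ S. Then every type A ∈ M whose graph E(A) is connected belongs to S. -/

import Mathlib

open Finset Pointwise

/-- The bipartite graph on vertex set `α ⊕ β` whose edges are the pairs in `S`. -/
def bipGraph {α β : Type*} (S : Set (α × β)) : SimpleGraph (α ⊕ β) where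
  Adj u v := ∃ a b, (a, b) ∈ S ∧
    ((u = Sum.inl a ∧ v = Sum.inr b) ∨ (u = Sum.inr b ∧ v = Sum.inl a))
  symm := by
    constructor
    rintro u v ⟨a, b, h, (⟨rfl, rfl⟩ | ⟨rfl, rfl⟩)⟩
    · exact ⟨a, b, h, Or.inr ⟨rfl, rfl⟩⟩
    · exact ⟨a, b, h, Or.inl ⟨rfl, rfl⟩⟩
  loopless := by
    constructor
    rintro u ⟨a, b, h, (⟨rfl, hv⟩ | ⟨rfl, hv⟩)⟩ <;> simp at hv

/-- The edge set of an `(n,d)`-type. -/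
def typeEdges {n d : ℕ} (A : Fin n → Finset (Fin d)) : Set (Fin n × Fin d) :=
  {p | p.2 ∈ A p.1}

/-- A subgraph of `K_{n,d}` is connected. -/
def IsConn {n d : ℕ} (S : Set (Fin n × Fin d)) : Prop :=
  (bipGraph S).Connected

/-- `A` is an `(n,d)`-type: every coordinate is nonempty. -/
def IsType {n d : ℕ} (A : Fin n → Finset (Fin d)) : Prop := ∀ i, (A i).Nonempty

/-- Compatibility of two subgraphs of `K_{n,d}`. -/
def Compatible {n d : ℕ} (A B : Set (Fin n × Fin d)) : Prop :=
  ∀ (k : ℕ) (i : Fin (k + 2) → Fin n) (j : Fin (k + 2) → Fin d),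
    Function.Injective i → Function.Injective j →
    (∀ t, (i t, j t) ∈ A) → (∀ t, (i (t + 1), j t) ∈ B) →
    ∀ t, (i t, j t) ∈ A ∧ (i t, j t) ∈ B ∧ (i (t + 1), j t) ∈ A ∧ (i (t + 1), j t) ∈ B

/-- An ordered partition of `Fin d` into nonempty parts. -/
structure OrderedPartition (d : ℕ) where
  r : ℕ
  parts : Fin r → Finset (Fin d)
  nonempty : ∀ k, (parts k).Nonempty
  disjoint : ∀ k l, k ≠ l → Disjoint (parts k) (parts l)
  covers : ∀ j, ∃ k, j ∈ parts k

/-- `B` is the refinement of `A` with respect to the ordered partition `P`. -/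
def IsRefinement {n d : ℕ} (A : Fin n → Finset (Fin d)) (P : OrderedPartition d)
    (B : Fin n → Finset (Fin d)) : Prop :=
  ∀ i, ∃ k, B i = A i ∩ P.parts k ∧ (A i ∩ P.parts k).Nonempty ∧
    ∀ l, l < k → A i ∩ P.parts l = ∅

/-- `B` is the total refinement of `A` with respect to the linear order on `Fin d` whose
rank function is `σ`. -/
def IsTotalRefinement {n d : ℕ} (A : Fin n → Finset (Fin d)) (σ : Equiv.Perm (Fin d))
    (B : Fin n → Finset (Fin d)) : Prop :=
  ∀ i, ∃ j ∈ A i, B i = {j} ∧ ∀ j' ∈ A i, σ j ≤ σ j'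

/-- The type associated to a subgraph `G` of `K_{n,d}`. -/
def graphType {n d : ℕ} (G : Finset (Fin n × Fin d)) : Fin n → Finset (Fin d) :=
  fun i => Finset.univ.filter fun j => (i, j) ∈ G

/-- `M` is a `G`-tropical oriented matroid. -/
structure IsGTOM {n d : ℕ} (G : Finset (Fin n × Fin d))
    (M : Set (Fin n → Finset (Fin d))) : Prop where
  isType : ∀ A ∈ M, IsType A
  subgraph : ∀ A ∈ M, typeEdges A ⊆ (↑G : Set (Fin n × Fin d))
  boundary : ∀ (σ : Equiv.Perm (Fin d)) (B : Fin n → Finset (Fin d)),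
    IsTotalRefinement (graphType G) σ B → B ∈ M
  surrounding : ∀ A ∈ M, ∀ (P : OrderedPartition d) (B : Fin n → Finset (Fin d)),
    IsRefinement A P B → B ∈ M
  comparability : ∀ A ∈ M, ∀ B ∈ M, Compatible (typeEdges A) (typeEdges B)
  elimination : ∀ A ∈ M, ∀ B ∈ M, ∀ i : Fin n, ∃ C ∈ M,
    C i = A i ∪ B i ∧ ∀ i', C i' = A i' ∨ C i' = B i' ∨ C i' = A i' ∪ B i'

/-- The vertex of `Δ^{n-1} × Δ^{d-1}` associated to a pair `(i, j)`. -/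
def rootVert {n d : ℕ} (p : Fin n × Fin d) : (Fin n → ℝ) × (Fin d → ℝ) :=
  (Pi.single p.1 1, Pi.single p.2 1)

/-- The root polytope `Q_S` of a subgraph `S ⊆ K_{n,d}`. -/
def rootPoly {n d : ℕ} (S : Set (Fin n × Fin d)) : Set ((Fin n → ℝ) × (Fin d → ℝ)) :=
  convexHull ℝ (rootVert '' S)

/-- A collection `𝒢` of subgraphs encodes a polyhedral subdivision of `Q_G`. -/
def EncodesSubdivision {n d : ℕ} (G : Set (Fin n × Fin d))
    (𝒢 : Set (Set (Fin n × Fin d))) : Prop :=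
  (⋃ S ∈ 𝒢, rootPoly S) = rootPoly G ∧
  ∀ S ∈ 𝒢, ∀ T ∈ 𝒢, IsExtreme ℝ (rootPoly S) (rootPoly S ∩ rootPoly T) ∧
    IsExtreme ℝ (rootPoly T) (rootPoly S ∩ rootPoly T)

/-- Connectivity of the edge set `S` restricted to the vertex sets `I ⊕ J`. -/
def connOn {n d : ℕ} (I : Set (Fin n)) (J : Set (Fin d)) (S : Set (Fin n × Fin d)) : Prop :=
  (bipGraph {p : ↥I × ↥J | ((p.1 : Fin n), (p.2 : Fin d)) ∈ S}).Connected

/-- The generalized permutohedron (Minkowski sum of faces of the simplex). -/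
def gPerm {n d : ℕ} (J : Fin n → Finset (Fin d)) : Set (Fin d → ℝ) :=
  ∑ i : Fin n, convexHull ℝ ((fun j => Pi.single j (1 : ℝ)) '' ↑(J i))

/-- One step `k → i → k'` with `k ∈ F i` and `k' ∈ A i`. -/
def stepR {n d : ℕ} (A F : Fin n → Finset (Fin d)) (k k' : Fin d) : Prop :=
  ∃ i, k ∈ F i ∧ k' ∈ A i

/-- The vertices of `Fin d` reachable from `a`. -/
noncomputable def reachR {n d : ℕ} (A F : Fin n → Finset (Fin d)) (a : Fin d) : Finset (Fin d) :=
  open Classical in Finset.univ.filter fun k => Relation.ReflTransGen (stepR A F) a k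

theorem mem_reachR {n d : ℕ} {A F : Fin n → Finset (Fin d)} {a k : Fin d} :
    k ∈ reachR A F a ↔ Relation.ReflTransGen (stepR A F) a k := by
  simp [reachR]

/-- Walks of a given length, as functions. -/
theorem exists_walk {n d : ℕ} {A F : Fin n → Finset (Fin d)} {a k : Fin d} (i₀ : Fin n)
    (h : Relation.ReflTransGen (stepR A F) a k) :
    ∃ (m : ℕ) (κ : ℕ → Fin d) (ι : ℕ → Fin n), κ 0 = a ∧ κ m = k ∧
      ∀ t < m, κ t ∈ F (ι t) ∧ κ (t + 1) ∈ A (ι t) := by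
  induction h with
  | refl => exact ⟨0, fun _ => a, fun _ => i₀, rfl, rfl, by simp⟩
  | @tail b c _ hbc ih =>
    obtain ⟨m, κ, ι, h0, hm, hs⟩ := ih
    obtain ⟨i, hb, hc⟩ := hbc
    refine ⟨m + 1, fun t => if t ≤ m then κ t else c, fun t => if t < m then ι t else i,
      by simp [h0], by simp, ?_⟩
    intro t ht
    rcases Nat.lt_or_ge t m with h | h
    · have := hs t h
      simpa [h, h.le, Nat.succ_le_of_lt h] using this
    · obtain rfl : t = m := by omega
      simp [hm, hb, hc]

theorem walk_closed {n d : ℕ} {A F : Fin n → Finset (Fin d)}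
    (hc : Compatible (typeEdges A) (typeEdges F)) :
    ∀ (m : ℕ) (κ : ℕ → Fin d) (ι : ℕ → Fin n) (i : Fin n),
      κ 0 ∈ A i → κ m ∈ F i → (∀ t < m, κ t ∈ F (ι t) ∧ κ (t + 1) ∈ A (ι t)) →
      κ m ∈ A i ∧ κ 0 ∈ F i := by
  intro m
  induction m using Nat.strong_induction_on with
  | _ m ih =>
  intro κ ι i hA hF hs
  rcases m with _ | m
  · exact ⟨hA, hF⟩
  by_cases hk : ∃ s t, s < t ∧ t ≤ m + 1 ∧ κ s = κ t
  · obtain ⟨s, t, hst, htm, he⟩ := hk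
    have := ih (m + 1 - (t - s)) (by omega) (fun u => if u ≤ s then κ u else κ (u + (t - s)))
      (fun u => if u < s then ι u else ι (u + (t - s))) i (by simpa using hA) ?_ ?_
    · have e : (if m + 1 - (t - s) ≤ s then κ (m + 1 - (t - s)) else
          κ (m + 1 - (t - s) + (t - s))) = κ (m + 1) := by
        split_ifs with h
        · have h1 : m + 1 - (t - s) = s := by omega
          have h2 : t = m + 1 := by omega
          rw [h1, he, h2]
        · congr 1; omega
      simp only [e] at this
      simpa using this
    · have e : (if m + 1 - (t - s) ≤ s then κ (m + 1 - (t - s)) else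
          κ (m + 1 - (t - s) + (t - s))) = κ (m + 1) := by
        split_ifs with h
        · have h1 : m + 1 - (t - s) = s := by omega
          have h2 : t = m + 1 := by omega
          rw [h1, he, h2]
        · congr 1; omega
      simp only [e]; exact hF
    · intro u hu
      rcases lt_trichotomy u s with h | h | h
      · have := hs u (by omega)
        simpa [h, h.le, Nat.succ_le_of_lt h] using this
      · subst h
        have := hs t (by omega)
        have e1 : u + (t - u) = t := by omega
        have e2 : u + 1 + (t - u) = t + 1 := by omega
        simpa [e1, e2, he] using this
      · have := hs (u + (t - s)) (by omega)
        have e2 : u + 1 + (t - s) = u + (t - s) + 1 := by omega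
        have h1 : ¬ u ≤ s := by omega
        have h2 : ¬ u + 1 ≤ s := by omega
        have h3 : ¬ u < s := by omega
        simpa only [h1, h2, h3, e2, if_false] using this
  by_cases hi : ∃ s t, s < t ∧ t ≤ m ∧ ι s = ι t
  · obtain ⟨s, t, hst, htm, he⟩ := hi
    have e : (if m + 1 - (t - s) ≤ s then κ (m + 1 - (t - s)) else
          κ (m + 1 - (t - s) + (t - s))) = κ (m + 1) := by
      rw [if_neg (by omega)]
      congr 1; omega
    have := ih (m + 1 - (t - s)) (by omega) (fun u => if u ≤ s then κ u else κ (u + (t - s)))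
      (fun u => if u ≤ s then ι u else ι (u + (t - s))) i (by simpa using hA)
      (by simp only [e]; exact hF) ?_
    · simp only [e] at this
      simpa using this
    · intro u hu
      rcases lt_trichotomy u s with h | h | h
      · have := hs u (by omega)
        simpa [h, h.le, Nat.succ_le_of_lt h] using this
      · subst h
        have h1 := hs t (by omega)
        have h2 := hs u (by omega)
        have e2 : u + 1 + (t - u) = t + 1 := by omega
        simp only [le_refl, if_true, e2]
        rw [if_neg (by omega)]
        exact ⟨h2.1, he ▸ h1.2⟩
      · have := hs (u + (t - s)) (by omega)
        have e2 : u + 1 + (t - s) = u + (t - s) + 1 := by omega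
        have h1 : ¬ u ≤ s := by omega
        have h2 : ¬ u + 1 ≤ s := by omega
        simpa only [h1, h2, e2, if_false] using this
  by_cases hii : ∃ s, s ≤ m ∧ ι s = i
  · obtain ⟨s, hsm, rfl⟩ := hii
    have h1 := ih s (by omega) κ ι (ι s) hA (hs s (by omega)).1 (fun t ht => hs t (by omega))
    have h2 := ih (m - s) (by omega) (fun u => κ (u + (s + 1))) (fun u => ι (u + (s + 1))) (ι s)
      (by simpa using (hs s (by omega)).2)
      (by
        have : m - s + (s + 1) = m + 1 := by omega
        simpa only [this] using hF)
      (fun t ht => by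
        have := hs (t + (s + 1)) (by omega)
        have e : t + 1 + (s + 1) = t + (s + 1) + 1 := by omega
        simpa only [e] using this)
    have : m - s + (s + 1) = m + 1 := by omega
    simp only [this] at h2
    exact ⟨h2.1, h1.2⟩
  push Not at hk hi hii
  have hkinj : ∀ s t, s ≤ m + 1 → t ≤ m + 1 → κ s = κ t → s = t := by
    intro s t h1 h2 h
    rcases lt_trichotomy s t with h' | h' | h'
    · exact absurd h (hk s t h' h2)
    · exact h'
    · exact absurd h.symm (hk t s h' h1)
  have hiinj : ∀ s t, s ≤ m → t ≤ m → ι s = ι t → s = t := by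
    intro s t h1 h2 h
    rcases lt_trichotomy s t with h' | h' | h'
    · exact absurd h (hi s t h' h2)
    · exact h'
    · exact absurd h.symm (hi t s h' h1)
  have key := hc m (fun t => if t.val = 0 then i else ι (t.val - 1)) (fun t => κ t.val) ?_ ?_ ?_ ?_
  · have k0 := key 0
    have k1 := key (Fin.last (m + 1))
    simp [typeEdges] at k0 k1
    exact ⟨k1.2.2.1, k0.2.1⟩
  · intro s t h
    apply Fin.ext
    have hs' := s.isLt
    have ht' := t.isLt
    simp only at h
    split_ifs at h with h1 h2 h2
    · omega
    · exact absurd h.symm (hii _ (by omega))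
    · exact absurd h (hii _ (by omega))
    · have := hiinj _ _ (by omega) (by omega) h
      omega
  · intro s t h
    apply Fin.ext
    exact hkinj _ _ (by omega) (by omega) h
  · intro t
    simp only [typeEdges, Set.mem_ofPred_eq]
    split_ifs with h
    · rw [h]; exact hA
    · have := (hs (t.val - 1) (by omega)).2
      have e : t.val - 1 + 1 = t.val := by omega
      rwa [e] at this
  · intro t
    simp only [typeEdges, Set.mem_ofPred_eq]
    rcases Nat.lt_or_ge t.val (m + 1) with h | h
    · have e : (t + 1).val = t.val + 1 := by
        rw [Fin.val_add_one_of_lt]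
        exact h
      rw [e]
      simpa using (hs t.val h).1
    · have e : t = Fin.last (m + 1) := by
        apply Fin.ext; simp; omega
      subst e
      simpa using hF

/-- An edge pair on a closed directed walk belongs to both types. -/
theorem closed_mem {n d : ℕ} {A F : Fin n → Finset (Fin d)}
    (hc : Compatible (typeEdges A) (typeEdges F)) {i : Fin n} {a k : Fin d}
    (ha : a ∈ A i) (hk : k ∈ F i) (h : k ∈ reachR A F a) : k ∈ A i ∧ a ∈ F i := by
  obtain ⟨m, κ, ι, h0, hm, hs⟩ := exists_walk i (mem_reachR.1 h)
  subst h0 hm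
  exact walk_closed hc m κ ι i ha hk hs

theorem compat_sub {n d : ℕ} {A A' B : Fin n → Finset (Fin d)}
    (hc : Compatible (typeEdges A) (typeEdges B)) (hsub : ∀ i, A' i ⊆ A i)
    (h : ∀ i j i', j ∈ A i → j ∈ B i → (A' i).Nonempty → j ∈ A' i' → j ∈ A' i) :
    Compatible (typeEdges A') (typeEdges B) := by
  intro k i j hi hj hA hB t
  have hh := hc k i j hi hj (fun t => hsub _ (hA t)) hB t
  refine ⟨hA t, hh.2.1, ?_, hh.2.2.2⟩
  exact h _ _ (i t) hh.2.2.1 hh.2.2.2 ⟨_, hA (t + 1)⟩ (hA t)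

/-- Sub-graph of `G` picking the edges of minimal weight. -/
def wGraph {n d : ℕ} (G : Finset (Fin n × Fin d)) (w : Fin d → ℕ) : Finset (Fin n × Fin d) :=
  G.filter fun p => ∀ j', (p.1, j') ∈ G → w p.2 ≤ w j'

theorem mem_wGraph {n d : ℕ} {G : Finset (Fin n × Fin d)} {w : Fin d → ℕ} {i : Fin n} {j : Fin d} :
    (i, j) ∈ wGraph G w ↔ (i, j) ∈ G ∧ ∀ j', (i, j') ∈ G → w j ≤ w j' := by
  simp [wGraph]

theorem mem_graphType {n d : ℕ} {G : Finset (Fin n × Fin d)} {i : Fin n} {j : Fin d} :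
    j ∈ graphType G i ↔ (i, j) ∈ G := by
  simp [graphType]

theorem wGraph_nonempty {n d : ℕ} {G : Finset (Fin n × Fin d)} (w : Fin d → ℕ)
    (hG : ∀ i, (graphType G i).Nonempty) (i : Fin n) : (graphType (wGraph G w) i).Nonempty := by
  obtain ⟨j, hj, hmin⟩ := Finset.exists_min_image _ w (hG i)
  refine ⟨j, ?_⟩
  rw [mem_graphType, mem_wGraph]
  exact ⟨mem_graphType.1 hj, fun j' h => hmin j' (mem_graphType.2 h)⟩

theorem perm_of_inj {d : ℕ} (f : Fin d → ℕ) (hf : Function.Injective f) :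
    ∃ σ : Equiv.Perm (Fin d), ∀ x y, f x ≤ f y → σ x ≤ σ y := by
  refine ⟨(Tuple.sort f)⁻¹, fun x y h => ?_⟩
  by_contra hlt
  push Not at hlt
  have := Tuple.monotone_sort f hlt.le
  simp at this
  have e := hf (le_antisymm h this)
  subst e
  exact lt_irrefl _ hlt

theorem exists_total {n d : ℕ} (A : Fin n → Finset (Fin d)) (hA : ∀ i, (A i).Nonempty)
    (σ : Equiv.Perm (Fin d)) : ∃ B, IsTotalRefinement A σ B := by
  have : ∀ i, ∃ j ∈ A i, ∀ j' ∈ A i, σ j ≤ σ j' := fun i => Finset.exists_min_image _ σ (hA i)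
  choose f hf hm using this
  exact ⟨fun i => {f i}, fun i => ⟨f i, hf i, rfl, hm i⟩⟩

theorem total_of_w {n d : ℕ} {G : Finset (Fin n × Fin d)} {w : Fin d → ℕ}
    {σ : Equiv.Perm (Fin d)} {B : Fin n → Finset (Fin d)}
    (h : IsTotalRefinement (graphType (wGraph G w)) σ B) :
    ∃ σ', IsTotalRefinement (graphType G) σ' B := by
  obtain ⟨σ', hσ'⟩ := perm_of_inj (fun x => w x * d + (σ x).val) (by
    intro x y hxy
    have h1 := (σ x).isLt
    have h2 := (σ y).isLt
    simp only at hxy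
    have : (σ x).val = (σ y).val := by
      have e1 : (w x * d + (σ x).val) % d = (σ x).val := by
        rw [Nat.mul_comm, Nat.mul_add_mod, Nat.mod_eq_of_lt h1]
      have e2 : (w y * d + (σ y).val) % d = (σ y).val := by
        rw [Nat.mul_comm, Nat.mul_add_mod, Nat.mod_eq_of_lt h2]
      rw [← e1, ← e2, hxy]
    exact σ.injective (Fin.ext this))
  refine ⟨σ', fun i => ?_⟩
  obtain ⟨j, hj, hB, hmin⟩ := h i
  rw [mem_graphType, mem_wGraph] at hj
  refine ⟨j, mem_graphType.2 hj.1, hB, fun j' hj' => hσ' _ _ ?_⟩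
  rw [mem_graphType] at hj'
  have h1 := hj.2 j' hj'
  rcases h1.lt_or_eq with h2 | h2
  · have h3 := (σ j).isLt
    have : (w j + 1) * d ≤ w j' * d := Nat.mul_le_mul_right _ h2
    nlinarith
  · have h4 := hmin j' (by
      rw [mem_graphType, mem_wGraph]
      exact ⟨hj', fun x hx => h2 ▸ hj.2 x hx⟩)
    simp only [h2]
    exact Nat.add_le_add_left h4 _

theorem gtom_w {n d : ℕ} {G : Finset (Fin n × Fin d)} {N : Set (Fin n → Finset (Fin d))}
    (hN : IsGTOM G N) (w : Fin d → ℕ) :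
    IsGTOM (wGraph G w) {B | B ∈ N ∧ ∀ i, B i ⊆ graphType (wGraph G w) i} where
  isType := fun A hA => hN.isType A hA.1
  subgraph := by
    rintro A ⟨_, hA⟩ ⟨i, j⟩ hp
    exact mem_graphType.1 (hA i hp)
  boundary := by
    intro σ B hB
    obtain ⟨σ', h'⟩ := total_of_w hB
    refine ⟨hN.boundary σ' B h', fun i => ?_⟩
    obtain ⟨j, hj, e, _⟩ := hB i
    rw [e]
    simpa using hj
  surrounding := by
    rintro A ⟨hA, hA'⟩ P B hB
    refine ⟨hN.surrounding A hA P B hB, fun i => ?_⟩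
    obtain ⟨k, e, _⟩ := hB i
    rw [e]
    exact Finset.inter_subset_left.trans (hA' i)
  comparability := fun A hA B hB => hN.comparability A hA.1 B hB.1
  elimination := by
    rintro A ⟨hA, hA'⟩ B ⟨hB, hB'⟩ i
    obtain ⟨C, hC, h1, h2⟩ := hN.elimination A hA B hB i
    refine ⟨C, ⟨hC, fun i' => ?_⟩, h1, h2⟩
    rcases h2 i' with h | h | h <;> rw [h]
    · exact hA' i'
    · exact hB' i'
    · exact Finset.union_subset (hA' i') (hB' i')

theorem refine_two {n d : ℕ} {G : Finset (Fin n × Fin d)} {N : Set (Fin n → Finset (Fin d))}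
    (hN : IsGTOM G N) {A : Fin n → Finset (Fin d)} (hA : A ∈ N) (J : Finset (Fin d))
    (h1 : J.Nonempty) (h2 : Jᶜ.Nonempty) :
    ∃ B ∈ N, ∀ i, ((A i ∩ J).Nonempty → B i = A i ∩ J) ∧ (A i ∩ J = ∅ → B i = A i) := by
  classical
  let P : OrderedPartition d :=
    { r := 2
      parts := ![J, Jᶜ]
      nonempty := by
        intro k; fin_cases k
        · exact h1
        · exact h2
      disjoint := by
        intro k l hkl
        fin_cases k <;> fin_cases l
        · exact absurd rfl hkl
        · exact disjoint_compl_right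
        · exact disjoint_compl_left
        · exact absurd rfl hkl
      covers := by
        intro j
        by_cases h : j ∈ J
        · exact ⟨0, h⟩
        · exact ⟨1, by simpa using h⟩ }
  refine ⟨fun i => if (A i ∩ J).Nonempty then A i ∩ J else A i, ?_, ?_⟩
  · apply hN.surrounding A hA P
    intro i
    by_cases h : (A i ∩ J).Nonempty
    · refine ⟨(0 : Fin 2), if_pos h, h, ?_⟩
      intro l hl
      exact absurd hl (Fin.not_lt_zero l)
    · have h' := Finset.not_nonempty_iff_eq_empty.1 h
      have e : A i ∩ Jᶜ = A i := by
        apply Finset.inter_eq_left.2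
        intro x hx
        rw [Finset.mem_compl]
        intro hxJ
        exact h ⟨x, Finset.mem_inter.2 ⟨hx, hxJ⟩⟩
      refine ⟨(1 : Fin 2), (if_neg h).trans e.symm, ?_, ?_⟩
      · change (A i ∩ Jᶜ).Nonempty
        rw [e]; exact hN.isType A hA i
      · intro l hl
        have : l = (0 : Fin 2) := by
          have : l.val < 1 := hl
          apply Fin.ext
          show l.val = 0
          omega
        subst this
        exact h'
  · intro i
    refine ⟨fun h => if_pos h, fun h => if_neg (by simp [h])⟩

/-- If some member of `N` contains `A` on `T`, then some member equals `A` on `T`. -/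
theorem shrink {n d : ℕ} {G : Finset (Fin n × Fin d)} {N : Set (Fin n → Finset (Fin d))}
    (hN : IsGTOM G N) (T : Finset (Fin n)) (A : Fin n → Finset (Fin d))
    (hAne : ∀ i ∈ T, (A i).Nonempty)
    (hcomp : ∀ B ∈ N, Compatible (typeEdges A) (typeEdges B))
    (hex : ∃ F ∈ N, ∀ i ∈ T, A i ⊆ F i) : ∃ B ∈ N, ∀ i ∈ T, B i = A i := by
  classical
  obtain ⟨F, ⟨hF, hFA⟩, hmin⟩ := exists_minimalFor_of_wellFoundedLT
    (fun F : Fin n → Finset (Fin d) => F ∈ N ∧ ∀ i ∈ T, A i ⊆ F i)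
    (fun F => ∑ i ∈ T, (F i).card) hex
  refine ⟨F, hF, ?_⟩
  by_contra hne
  push Not at hne
  obtain ⟨i, hi, hne⟩ := hne
  have : ¬ F i ⊆ A i := fun h => hne (h.antisymm (hFA i hi))
  obtain ⟨k, hkF, hkA⟩ := Finset.not_subset.1 this
  let J : Finset (Fin d) := (A i).biUnion (reachR A F)
  have hAJ : A i ⊆ J := fun a ha => Finset.mem_biUnion.2 ⟨a, ha, mem_reachR.2 .refl⟩
  have hkJ : k ∉ J := by
    intro h
    obtain ⟨a, ha, hr⟩ := Finset.mem_biUnion.1 h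
    exact hkA (closed_mem (hcomp F hF) ha hkF hr).1
  obtain ⟨B, hB, hB'⟩ := refine_two hN hF J ((hAne i hi).mono hAJ) ⟨k, by simpa using hkJ⟩
  have hgood : ∀ i' ∈ T, A i' ⊆ B i' := by
    intro i' hi'
    by_cases h : (F i' ∩ J).Nonempty
    · rw [(hB' i').1 h]
      refine Finset.subset_inter (hFA i' hi') ?_
      obtain ⟨x, hx⟩ := h
      rw [Finset.mem_inter] at hx
      obtain ⟨a, ha, hr⟩ := Finset.mem_biUnion.1 hx.2
      intro y hy
      exact Finset.mem_biUnion.2 ⟨a, ha, mem_reachR.2 ((mem_reachR.1 hr).tail ⟨i', hx.1, hy⟩)⟩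
    · rw [(hB' i').2 (Finset.not_nonempty_iff_eq_empty.1 h)]
      exact hFA i' hi'
  have hsub : ∀ i', B i' ⊆ F i' := by
    intro i'
    by_cases h : (F i' ∩ J).Nonempty
    · rw [(hB' i').1 h]; exact Finset.inter_subset_left
    · rw [(hB' i').2 (Finset.not_nonempty_iff_eq_empty.1 h)]
  have hlt : ∑ i ∈ T, (B i).card < ∑ i ∈ T, (F i).card := by
    apply Finset.sum_lt_sum (fun i' _ => Finset.card_le_card (hsub i'))
    refine ⟨i, hi, Finset.card_lt_card ?_⟩
    refine (Finset.ssubset_iff_of_subset (hsub i)).2 ⟨k, hkF, ?_⟩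
    have h : (F i ∩ J).Nonempty := by
      obtain ⟨a, ha⟩ := hAne i hi
      exact ⟨a, Finset.mem_inter.2 ⟨hFA i hi ha, hAJ ha⟩⟩
    rw [(hB' i).1 h]
    simp [hkJ]
  have := hmin ⟨hB, hgood⟩ hlt.le
  simp only at this
  omega

/-- A partial type inside `G` which is compatible with all of `N` extends to a member of `N`. -/
theorem key_ext {n d : ℕ} : ∀ (c : ℕ) (G : Finset (Fin n × Fin d))
    (N : Set (Fin n → Finset (Fin d))), G.card = c → IsGTOM G N →
    (∀ i, (graphType G i).Nonempty) → ∀ (T : Finset (Fin n)) (A : Fin n → Finset (Fin d)),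
    (∀ i ∈ T, (A i).Nonempty) → (∀ i, i ∉ T → A i = ∅) → (∀ i, A i ⊆ graphType G i) →
    (∀ B ∈ N, Compatible (typeEdges A) (typeEdges B)) → ∃ B ∈ N, ∀ i ∈ T, B i = A i := by
  classical
  intro c
  induction c using Nat.strong_induction_on with
  | _ c ihc =>
  intro G N hcard hN hG T
  induction T using Finset.induction_on with
  | empty =>
    intro A _ _ _ _
    obtain ⟨B, hB⟩ := exists_total _ hG 1
    exact ⟨B, hN.boundary 1 B hB, by simp⟩
  | insert p T hp ihT =>
  intro A hne hempty hAG hcomp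
  apply shrink hN _ A hne hcomp
  -- the element given by deleting `p`
  obtain ⟨H0, hH0, hH0A⟩ := ihT (fun i => if i = p then ∅ else A i)
    (fun i hi => by
      have : i ≠ p := fun h => hp (h ▸ hi)
      simpa [this] using hne i (Finset.mem_insert_of_mem hi))
    (fun i hi => by
      by_cases h : i = p
      · simp [h]
      · simpa [h] using hempty i (by simp [h, hi]))
    (fun i => by
      by_cases h : i = p
      · simp [h]
      · simpa [h] using hAG i)
    (fun B hB => compat_sub (hcomp B hB)
      (fun i => by by_cases h : i = p <;> simp [h])
      (fun i j i' h1 h2 h3 h4 => by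
        by_cases h : i = p
        · simp [h] at h3
        · simpa [h] using h1))
  by_contra hcon
  push Not at hcon
  have hbadp : ∀ F ∈ N, (∀ i ∈ T, A i ⊆ F i) → ∃ a ∈ A p, a ∉ F p := by
    intro F hF hFA
    obtain ⟨i, hi, hi'⟩ := hcon F hF
    rcases Finset.mem_insert.1 hi with rfl | h
    · exact Finset.not_subset.1 hi'
    · exact absurd (hFA i h) hi'
  have hH0' : ∀ i ∈ T, A i ⊆ H0 i := by
    intro i hi
    have : i ≠ p := fun h => hp (h ▸ hi)
    rw [hH0A i hi]
    simp [this]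
  obtain ⟨a0, ha0, ha0'⟩ := hbadp H0 hH0 hH0'
  let Pairs : Finset ((Fin n → Finset (Fin d)) × Fin d) := Finset.univ.filter fun q =>
    q.1 ∈ N ∧ (∀ i ∈ T, A i ⊆ q.1 i) ∧ q.2 ∈ A p ∧ q.2 ∉ q.1 p
  obtain ⟨⟨H, a⟩, hmem, hmax⟩ := Finset.exists_max_image Pairs
    (fun q => (q.1 p ∩ A p).card * (d + 1) + (reachR A q.1 q.2).card)
    ⟨(H0, a0), by simp only [Pairs, Finset.mem_filter, Finset.mem_univ, true_and]
                  exact ⟨hH0, hH0', ha0, ha0'⟩⟩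
  simp only [Pairs, Finset.mem_filter, Finset.mem_univ, true_and] at hmem hmax
  obtain ⟨hH, hHA, ha, haH⟩ := hmem
  set J := reachR A H a with hJ
  have haJ : a ∈ J := mem_reachR.2 .refl
  have hstep : ∀ i k y, k ∈ H i → k ∈ J → y ∈ A i → y ∈ J := by
    intro i k y h1 h2 h3
    exact mem_reachR.2 ((mem_reachR.1 h2).tail ⟨i, h1, h3⟩)
  have hpJ : ∀ k ∈ H p, k ∉ J := fun k hk hkJ => haH (closed_mem (hcomp H hH) ha hk hkJ).2
  -- push the complement of `J` to infinity
  let w : Fin d → ℕ := fun j => if j ∈ J then 0 else 1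
  have hwsub : wGraph G w ⊆ G := Finset.filter_subset _ _
  have hwJ : ∀ i j, (∃ x ∈ J, (i, x) ∈ G) → (i, j) ∈ wGraph G w → j ∈ J := by
    rintro i j ⟨x, hx, hxG⟩ h
    have := (mem_wGraph.1 h).2 x hxG
    by_contra hj
    simp [w, hx, hj] at this
  have hJw : ∀ i j, (i, j) ∈ G → j ∈ J → (i, j) ∈ wGraph G w := by
    intro i j h hj
    exact mem_wGraph.2 ⟨h, fun j' _ => by simp [w, hj]⟩
  have hHG : ∀ i j, j ∈ H i → (i, j) ∈ G := fun i j h => hN.subgraph H hH (a := (i, j)) h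
  have haG : (p, a) ∈ G := mem_graphType.1 (hAG p ha)
  have hlt : (wGraph G w).card < c := by
    rw [← hcard]
    apply Finset.card_lt_card
    obtain ⟨h, hh⟩ := hN.isType H hH p
    refine (Finset.ssubset_iff_of_subset hwsub).2 ⟨(p, h), hHG p h hh, fun h' => ?_⟩
    exact hpJ h hh (hwJ p h ⟨a, haJ, haG⟩ h')
  let A' : Fin n → Finset (Fin d) := fun i =>
    if (H i ∩ J).Nonempty then H i ∩ J else if ∃ x ∈ J, (i, x) ∈ G then ∅ else H i
  have hA'1 : ∀ i, (H i ∩ J).Nonempty → A' i = H i ∩ J := fun i h => if_pos h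
  have hA'2 : ∀ i, (¬ ∃ x ∈ J, (i, x) ∈ G) → A' i = H i := by
    intro i h
    have h' : ¬ (H i ∩ J).Nonempty := by
      rintro ⟨x, hx⟩
      rw [Finset.mem_inter] at hx
      exact h ⟨x, hx.2, hHG i x hx.1⟩
    simp only [A', if_neg h', if_neg h]
  have hA'3 : ∀ i, ¬ (H i ∩ J).Nonempty → (∃ x ∈ J, (i, x) ∈ G) → A' i = ∅ := by
    intro i h h'
    simp only [A', if_neg h, if_pos h']
  have hA'sub : ∀ i, A' i ⊆ H i := by
    intro i
    by_cases h : (H i ∩ J).Nonempty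
    · rw [hA'1 i h]; exact Finset.inter_subset_left
    · by_cases h' : ∃ x ∈ J, (i, x) ∈ G
      · rw [hA'3 i h h']; simp
      · rw [hA'2 i h']
  obtain ⟨Q, ⟨hQ, hQw⟩, hQA⟩ := ihc _ hlt (wGraph G w) _ rfl (gtom_w hN w)
    (wGraph_nonempty w hG) (Finset.univ.filter fun i => (A' i).Nonempty) A'
    (fun i hi => by simpa using hi) (fun i hi => by simpa using hi)
    (fun i x hx => by
      rw [mem_graphType]
      have hxG := hHG i x (hA'sub i hx)
      by_cases h : (H i ∩ J).Nonempty
      · rw [hA'1 i h] at hx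
        exact hJw i x hxG (Finset.mem_inter.1 hx).2
      · by_cases h' : ∃ x ∈ J, (i, x) ∈ G
        · rw [hA'3 i h h'] at hx; simp at hx
        · refine mem_wGraph.2 ⟨hxG, fun j' hj' => ?_⟩
          have : j' ∉ J := fun h => h' ⟨j', h, hj'⟩
          simp only [w, this, if_false]
          split_ifs <;> omega)
    (fun B hB => compat_sub (hN.comparability H hH B hB.1) hA'sub
      (fun i j i' h1 h2 h3 h4 => by
        by_cases h : (H i ∩ J).Nonempty
        · rw [hA'1 i h]
          refine Finset.mem_inter.2 ⟨h1, ?_⟩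
          obtain ⟨x, hx⟩ := h
          rw [Finset.mem_inter] at hx
          exact hwJ i j ⟨x, hx.2, hHG i x hx.1⟩ (mem_graphType.1 (hB.2 i h2))
        · by_cases h' : ∃ x ∈ J, (i, x) ∈ G
          · rw [hA'3 i h h'] at h3; simp at h3
          · rw [hA'2 i h']; exact h1))
  have hQ1 : ∀ i, (H i ∩ J).Nonempty → Q i = H i ∩ J := by
    intro i h
    rw [← hA'1 i h]
    apply hQA
    simpa [hA'1 i h] using h
  have hQ2 : ∀ i, (¬ ∃ x ∈ J, (i, x) ∈ G) → Q i = H i := by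
    intro i h
    rw [← hA'2 i h]
    apply hQA
    simpa [hA'2 i h] using hN.isType H hH i
  have hQ3 : ∀ i, (∃ x ∈ J, (i, x) ∈ G) → Q i ⊆ J := fun i h x hx =>
    hwJ i x h (mem_graphType.1 (hQw i hx))
  -- reachability in any `X` keeping the ties inside `J`
  have hreach : ∀ X : Fin n → Finset (Fin d), (∀ i, H i ∩ J ⊆ X i) → J ⊆ reachR A X a := by
    intro X hX k hk
    have hk' := mem_reachR.1 hk
    rw [mem_reachR]
    induction hk' with
    | refl => exact .refl
    | @tail b e hb hbe ih =>
      obtain ⟨i, h1, h2⟩ := hbe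
      have hbJ : b ∈ J := mem_reachR.2 hb
      exact (ih hbJ).tail ⟨i, hX i (Finset.mem_inter.2 ⟨h1, hbJ⟩), h2⟩
  have hQJ : ∀ i, H i ∩ J ⊆ Q i := by
    intro i x hx
    rw [hQ1 i ⟨x, hx⟩]; exact hx
  have hQp : ∀ k ∈ Q p, k ∈ A p ∧ a ∈ Q p := fun k hk =>
    closed_mem (hcomp Q hQ) ha hk (hreach Q hQJ (hQ3 p ⟨a, haJ, haG⟩ hk))
  have haQ : a ∈ Q p := by
    obtain ⟨k, hk⟩ := hN.isType Q hQ p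
    exact (hQp k hk).2
  -- candidates
  let Pr : (Fin n → Finset (Fin d)) → Prop := fun X => X ∈ N ∧
    (X p = H p ∨ X p = H p ∪ Q p) ∧ (∀ i, X i = H i ∨ X i = Q i ∨ X i = H i ∪ Q i) ∧
    (X p = H p ∪ Q p ∨ ∃ i ∈ T, ¬ (H i ∩ J).Nonempty ∧ (∃ x ∈ J, (i, x) ∈ G) ∧ X i = H i ∪ Q i)
  obtain ⟨X1, hX1, hX1p, hX1i⟩ := hN.elimination H hH Q hQ p
  obtain ⟨X, ⟨hX, hXp, hXi, hXd⟩, hXmin⟩ := exists_minimalFor_of_wellFoundedLT Pr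
    (fun X => (T.filter fun i => ¬ A i ⊆ X i).card)
    ⟨X1, hX1, Or.inr hX1p, hX1i, Or.inl hX1p⟩
  have hXgood : ∀ i ∈ T, A i ⊆ X i := by
    by_contra hbad
    push Not at hbad
    obtain ⟨i, hi, hib⟩ := hbad
    have hiH := hHA i hi
    have hXQ : X i = Q i := by
      rcases hXi i with h | h | h
      · exact absurd (h ▸ hiH) hib
      · exact h
      · exact absurd (h ▸ hiH.trans Finset.subset_union_left) hib
    have h1 : ¬ (H i ∩ J).Nonempty := by
      rintro ⟨x, hx⟩
      apply hib
      rw [hXQ, hQ1 i ⟨x, hx⟩]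
      rw [Finset.mem_inter] at hx
      exact fun y hy => Finset.mem_inter.2 ⟨hiH hy, hstep i x y hx.1 hx.2 hy⟩
    have h2 : ∃ x ∈ J, (i, x) ∈ G := by
      by_contra h
      apply hib
      rw [hXQ, hQ2 i h]; exact hiH
    obtain ⟨Y, hY, hYi, hYo⟩ := hN.elimination X hX H hH i
    have hip : i ≠ p := fun h => hp (h ▸ hi)
    have hYPr : Pr Y := by
      refine ⟨hY, ?_, ?_, Or.inr ⟨i, hi, h1, h2, ?_⟩⟩
      · rcases hYo p with h | h | h <;> rcases hXp with h' | h' <;> rw [h] <;> try rw [h']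
        all_goals simp
        right
        (ext x; simp only [Finset.mem_union]; tauto)
      · intro i'
        rcases hYo i' with h | h | h <;> rcases hXi i' with h' | h' | h' <;> rw [h] <;>
          try rw [h']
        all_goals simp
        · right; right; exact Finset.union_comm _ _
        · right; right
          (ext x; simp only [Finset.mem_union]; tauto)
      · rw [hYi, hXQ, Finset.union_comm]
    have hYlt : (T.filter fun i => ¬ A i ⊆ Y i).card < (T.filter fun i => ¬ A i ⊆ X i).card := by
      apply Finset.card_lt_card
      have hss : (T.filter fun i => ¬ A i ⊆ Y i) ⊆ (T.filter fun i => ¬ A i ⊆ X i) := by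
        intro i' hi'
        rw [Finset.mem_filter] at hi' ⊢
        refine ⟨hi'.1, fun hg => hi'.2 ?_⟩
        rcases hYo i' with h | h | h <;> rw [h]
        · exact hg
        · exact hHA i' hi'.1
        · exact hg.trans Finset.subset_union_left
      refine (Finset.ssubset_iff_of_subset hss).2 ⟨i, Finset.mem_filter.2 ⟨hi, hib⟩, fun h => ?_⟩
      apply (Finset.mem_filter.1 h).2
      rw [hYi]; exact hiH.trans Finset.subset_union_right
    have := hXmin hYPr hYlt.le
    simp only at this
    omega
  have hXJ : ∀ i, H i ∩ J ⊆ X i := by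
    intro i
    rcases hXi i with h | h | h <;> rw [h]
    · exact Finset.inter_subset_left
    · exact hQJ i
    · exact (hQJ i).trans Finset.subset_union_right
  have hcardle : ∀ s : Finset (Fin d), s.card ≤ d := fun s => by
    simpa using Finset.card_le_univ s
  by_cases hXpu : X p = H p ∪ Q p
  · -- more of `A p` is covered
    obtain ⟨b, hb, hbX⟩ := hbadp X hX hXgood
    have h1 := hmax (X, b) ⟨hX, hXgood, hb, hbX⟩
    simp only at h1
    have h2 : (H p ∩ A p).card < (X p ∩ A p).card := by
      apply Finset.card_lt_card
      have hss : H p ∩ A p ⊆ X p ∩ A p := by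
        rw [hXpu]
        exact Finset.inter_subset_inter_right Finset.subset_union_left
      refine (Finset.ssubset_iff_of_subset hss).2 ⟨a, ?_, ?_⟩
      · rw [hXpu]; simp [ha, haQ]
      · simp [haH]
    have h3 := hcardle J
    have h4 : ((H p ∩ A p).card + 1) * (d + 1) ≤ (X p ∩ A p).card * (d + 1) :=
      Nat.mul_le_mul_right _ h2
    nlinarith
  · -- the reachable set grows
    have hXH : X p = H p := hXp.resolve_right hXpu
    obtain ⟨i, hi, h1, h2, hiX⟩ := hXd.resolve_left hXpu
    have h3 := hmax (X, a) ⟨hX, hXgood, ha, by show a ∉ X p; rw [hXH]; exact haH⟩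
    simp only [hXH] at h3
    have h4 : J.card < (reachR A X a).card := by
      apply Finset.card_lt_card
      refine (Finset.ssubset_iff_of_subset (hreach X hXJ)).2 ?_
      obtain ⟨y, hy⟩ := hne i (Finset.mem_insert_of_mem hi)
      refine ⟨y, ?_, fun hyJ => h1 ⟨y, Finset.mem_inter.2 ⟨hHA i hi hy, hyJ⟩⟩⟩
      obtain ⟨x, hx⟩ := hN.isType Q hQ i
      have hxr := hreach X hXJ (hQ3 i h2 hx)
      refine mem_reachR.2 ((mem_reachR.1 hxr).tail ⟨i, ?_, hy⟩)
      rw [hiX]; exact Finset.mem_union_right _ hx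
    omega

/-- Sets built up one element at a time, each new element sharing a coordinate of `A` with
the earlier ones. -/
inductive Built {n d : ℕ} (A : Fin n → Finset (Fin d)) : Finset (Fin d) → Prop
  | single (j : Fin d) : Built A {j}
  | insert (J : Finset (Fin d)) (j : Fin d) (i : Fin n) (h : Built A J) (hj : j ∉ J)
      (hi : j ∈ A i) (hne : (A i ∩ J).Nonempty) : Built A (insert j J)

theorem built_univ {n d : ℕ} (hd : 0 < d) (A : Fin n → Finset (Fin d))
    (hc : IsConn (typeEdges A)) : Built A Finset.univ := by
  classical
  obtain ⟨J, hJ, hmax⟩ := Finset.exists_max_image (Finset.univ.filter fun J => Built A J)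
    Finset.card ⟨{⟨0, hd⟩}, by simpa using Built.single _⟩
  simp only [Finset.mem_filter, Finset.mem_univ, true_and] at hJ hmax
  have hJne : J.Nonempty := by
    cases hJ with
    | single j => simp
    | insert J j i h hj hi hne => simp
  have hcl : ∀ i, (A i ∩ J).Nonempty → A i ⊆ J := by
    intro i hi j hj
    by_contra hjJ
    have := hmax _ (Built.insert J j i hJ hjJ hj hi)
    rw [Finset.card_insert_of_notMem hjJ] at this
    omega
  have : J = Finset.univ := by
    obtain ⟨j0, hj0⟩ := hJne
    have hinv : ∀ v, Relation.ReflTransGen (bipGraph (typeEdges A)).Adj (Sum.inr j0) v →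
        Sum.elim (fun i => (A i ∩ J).Nonempty) (fun j => j ∈ J) v := by
      intro v hv
      induction hv with
      | refl => exact hj0
      | tail _ hbc ih =>
        obtain ⟨i, j, hij, (⟨rfl, rfl⟩ | ⟨rfl, rfl⟩)⟩ := hbc
        · exact hcl i ih hij
        · exact ⟨j, Finset.mem_inter.2 ⟨hij, ih⟩⟩
    ext j
    simp only [Finset.mem_univ, iff_true]
    have hr := hc.preconnected (Sum.inr j0) (Sum.inr j)
    rw [SimpleGraph.reachable_iff_reflTransGen] at hr
    exact hinv _ hr
  rwa [this] at hJ

theorem built_mem {n d : ℕ} (G : Finset (Fin n × Fin d)) (hG : ∀ i, (graphType G i).Nonempty)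
    (M : Set (Fin n → Finset (Fin d))) (hM : IsGTOM G M)
    (S : Set (Fin n → Finset (Fin d)))
    (hbd : ∀ (σ : Equiv.Perm (Fin d)) (B : Fin n → Finset (Fin d)),
      IsTotalRefinement (graphType G) σ B → B ∈ S)
    (hclosed : ∀ A ∈ S, ∀ B ∈ S, ∀ i : Fin n, ∀ C ∈ M,
      C i = A i ∪ B i → (∀ i', C i' = A i' ∨ C i' = B i' ∨ C i' = A i' ∪ B i') → C ∈ S)
    (A0 : Fin n → Finset (Fin d)) (J : Finset (Fin d)) (hJ : Built A0 J) :
    ∀ (w : Fin d → ℕ) (A : Fin n → Finset (Fin d)), A ∈ M →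
      (∀ i, A i ⊆ graphType (wGraph G w) i) → (∀ j, w j = 0 ↔ j ∈ J) →
      (∀ x y, x ∉ J → w x = w y → x = y) → (∀ i, A0 i ∩ J ⊆ A i) → A ∈ S := by
  classical
  induction hJ with
  | single j =>
    intro w A hA hAw hw0 hwinj _
    have hwi : Function.Injective w := by
      intro x y h
      by_cases hx : x = j
      · by_cases hy : y = j
        · rw [hx, hy]
        · exact (hwinj y x (by simpa using hy) h.symm).symm
      · exact hwinj x y (by simpa using hx) h
    obtain ⟨B, hB⟩ := exists_total _ (wGraph_nonempty w hG) 1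
    have hAB : A = B := by
      funext i
      obtain ⟨x, hx, e, _⟩ := hB i
      have hsing : ∀ y ∈ A i, y = x := by
        intro y hy
        have h1 := mem_wGraph.1 (mem_graphType.1 (hAw i hy))
        have h2 := mem_wGraph.1 (mem_graphType.1 hx)
        exact hwi (le_antisymm (h1.2 x h2.1) (h2.2 y h1.1))
      rw [e]
      exact Finset.eq_singleton_iff_nonempty_unique_mem.2 ⟨hM.isType A hA i, hsing⟩
    obtain ⟨σ', h'⟩ := total_of_w hB
    rw [hAB]
    exact hbd σ' B h'
  | insert J j i0 hJ hj hi0 hne ih =>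
    intro w A hA hAw hw0 hwinj hA0
    have hAG : ∀ i x, x ∈ A i → (i, x) ∈ G := fun i x hx =>
      (mem_wGraph.1 (mem_graphType.1 (hAw i hx))).1
    have hAmin : ∀ i x y, x ∈ A i → (i, y) ∈ G → w x ≤ w y := fun i x y hx hy =>
      (mem_wGraph.1 (mem_graphType.1 (hAw i hx))).2 y hy
    have hwj : w j = 0 := (hw0 j).2 (by simp)
    have hwJ : ∀ x ∈ J, w x = 0 := fun x hx => (hw0 x).2 (by simp [hx])
    have hw0' : ∀ x, w x = 0 → x = j ∨ x ∈ J := fun x hx => by simpa using (hw0 x).1 hx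
    -- the corner
    let u : Fin d → ℕ := fun x => if x = j then 0 else w x + 1
    obtain ⟨C, hC⟩ := exists_total _ (wGraph_nonempty u hG) 1
    have hCS : C ∈ S := by
      obtain ⟨σ', h'⟩ := total_of_w hC
      exact hbd σ' C h'
    have hCj : ∀ i, (i, j) ∈ G → C i = {j} := by
      intro i hi
      obtain ⟨x, hx, e, _⟩ := hC i
      have := (mem_wGraph.1 (mem_graphType.1 hx)).2 j hi
      have hxj : x = j := by
        by_contra hxj
        simp [u, hxj] at this
      rw [e, hxj]
    have hCo : ∀ i, (∀ x ∈ insert j J, (i, x) ∉ G) → C i = A i := by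
      intro i hi
      obtain ⟨x, hx, e, _⟩ := hC i
      have hx' := mem_wGraph.1 (mem_graphType.1 hx)
      have hxJ : x ∉ insert j J := fun h => hi x h hx'.1
      rw [e]
      symm
      refine Finset.eq_singleton_iff_nonempty_unique_mem.2 ⟨hM.isType A hA i, fun y hy => ?_⟩
      have h1 := hAmin i y x hy hx'.1
      have h2 := hx'.2 y (hAG i y hy)
      have hyJ : y ∉ insert j J := fun h => hi y h (hAG i y hy)
      have hxj : x ≠ j := fun h => hxJ (by simp [h])
      have hyj : y ≠ j := fun h => hyJ (by simp [h])
      simp only [u, if_neg hxj, if_neg hyj] at h2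
      exact hwinj y x hyJ (by omega)
    -- pushing `j` to infinity
    let w' : Fin d → ℕ := fun x => if x ∈ J then 0 else w x + 1
    obtain ⟨B, ⟨hBM, hBw⟩, hBA⟩ := key_ext _ (wGraph G w') _ rfl (gtom_w hM w')
      (wGraph_nonempty w' hG) (Finset.univ.filter fun i => (A i ∩ J).Nonempty) (fun i => A i ∩ J)
      (fun i hi => by simpa using hi) (fun i hi => by simpa using hi)
      (fun i x hx => by
        rw [Finset.mem_inter] at hx
        rw [mem_graphType, mem_wGraph]
        exact ⟨hAG i x hx.1, fun j' _ => by simp [w', hx.2]⟩)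
      (fun B hB => compat_sub (hM.comparability A hA B hB.1) (fun i => Finset.inter_subset_left)
        (fun i j i' h1 h2 h3 h4 =>
          Finset.mem_inter.2 ⟨h1, (Finset.mem_inter.1 h4).2⟩))
    have hBA' : ∀ i, (A i ∩ J).Nonempty → B i = A i ∩ J := fun i h => hBA i (by simpa using h)
    have hBS : B ∈ S := by
      apply ih w' B hBM hBw
      · intro x
        by_cases h : x ∈ J <;> simp [w', h]
      · intro x y hx hxy
        have hy : y ∉ J := by
          intro hy
          simp [w', hx, hy] at hxy
        simp only [w', if_neg hx, if_neg hy, Nat.add_right_cancel_iff] at hxy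
        by_cases hxj : x = j
        · subst hxj
          rcases hw0' y (by omega) with h | h
          · exact h.symm
          · exact absurd h hy
        · exact hwinj x y (by simp [hxj, hx]) hxy
      · intro i x hx
        rw [Finset.mem_inter] at hx
        have hxA : x ∈ A i := hA0 i (by simp [hx.1, hx.2])
        have hxm : x ∈ A i ∩ J := Finset.mem_inter.2 ⟨hxA, hx.2⟩
        rw [hBA' i ⟨x, hxm⟩]
        exact hxm
    -- elements of `A i` are zero-weight as soon as `G i` has one
    have hAz : ∀ i y, y ∈ insert j J → (i, y) ∈ G → ∀ x ∈ A i, x = j ∨ x ∈ J := by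
      intro i y hy hyG x hx
      have := hAmin i x y hx hyG
      rw [(hw0 y).2 hy] at this
      exact hw0' x (by omega)
    have hunion : ∀ i, j ∈ A i → (A i ∩ J).Nonempty → A i = B i ∪ C i := by
      intro i h1 h2
      rw [hBA' i h2, hCj i (hAG i j h1)]
      ext x
      simp only [Finset.mem_union, Finset.mem_inter, Finset.mem_singleton]
      constructor
      · intro hx
        rcases hAz i j (by simp) (hAG i j h1) x hx with h | h
        · exact Or.inr h
        · exact Or.inl ⟨hx, h⟩
      · rintro (h | rfl)
        · exact h.1
        · exact h1
    refine hclosed B hBS C hCS i0 A hA ?_ ?_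
    · apply hunion i0 (hA0 i0 (by simp [hi0]))
      obtain ⟨x, hx⟩ := hne
      rw [Finset.mem_inter] at hx
      exact ⟨x, Finset.mem_inter.2 ⟨hA0 i0 (by simp [hx.1, hx.2]), hx.2⟩⟩
    · intro i
      by_cases hjA : j ∈ A i
      · by_cases hAJ : (A i ∩ J).Nonempty
        · exact Or.inr (Or.inr (hunion i hjA hAJ))
        · refine Or.inr (Or.inl ?_)
          rw [hCj i (hAG i j hjA)]
          refine Finset.eq_singleton_iff_unique_mem.2 ⟨hjA, fun x hx => ?_⟩
          rcases hAz i j (by simp) (hAG i j hjA) x hx with h | h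
          · exact h
          · exact absurd ⟨x, Finset.mem_inter.2 ⟨hx, h⟩⟩ hAJ
      · by_cases hz : ∃ x ∈ insert j J, (i, x) ∈ G
        · obtain ⟨y, hy, hyG⟩ := hz
          have hsub : A i ⊆ J := by
            intro x hx
            rcases hAz i y hy hyG x hx with h | h
            · exact absurd (h ▸ hx) hjA
            · exact h
          have e : A i ∩ J = A i := Finset.inter_eq_left.2 hsub
          refine Or.inl ?_
          rw [hBA' i (by rw [e]; exact hM.isType A hA i), e]
        · push Not at hz
          exact Or.inr (Or.inl (hCo i hz).symm)

/-- every connected type of a `G`-tropical oriented matroid lies in the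
smallest subset of `M` containing all total refinements of `G` (the boundary types) and
closed under results of elimination; i.e. it lies in every such subset. -/
theorem gtom_connected_generated {n d : ℕ} (hn : 0 < n) (hd : 0 < d)
    (G : Finset (Fin n × Fin d)) (hGconn : IsConn (↑G : Set (Fin n × Fin d)))
    (M : Set (Fin n → Finset (Fin d))) (hM : IsGTOM G M)
    (S : Set (Fin n → Finset (Fin d))) (hSM : S ⊆ M)
    (hbd : ∀ (σ : Equiv.Perm (Fin d)) (B : Fin n → Finset (Fin d)),
      IsTotalRefinement (graphType G) σ B → B ∈ S)
    (hclosed : ∀ A ∈ S, ∀ B ∈ S, ∀ i : Fin n, ∀ C ∈ M,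
      C i = A i ∪ B i → (∀ i', C i' = A i' ∨ C i' = B i' ∨ C i' = A i' ∪ B i') → C ∈ S) :
    ∀ A ∈ M, IsConn (typeEdges A) → A ∈ S := by
  intro A hA hconn
  have hG : ∀ i, (graphType G i).Nonempty := by
    intro i
    obtain ⟨j, hj⟩ := hM.isType A hA i
    exact ⟨j, mem_graphType.2 (hM.subgraph A hA (a := (i, j)) hj)⟩
  refine built_mem G hG M hM S hbd hclosed A Finset.univ (built_univ hd A hconn)
    (fun _ => 0) A hA ?_ (by simp) (by simp) (by simp)
  intro i x hx
  rw [mem_graphType, mem_wGraph]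
  exact ⟨hM.subgraph A hA (a := (i, x)) hx, by simp⟩
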